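/- arXiv:0906.0294 — 12 statements merged into one kernel-verified Lean document; each statement's English description precedes it below -/
import Mathlib

section
/- Let Ω be a finite type. Every map φ : Set Ω → ZMod 2 with φ(∅) = 0 can be expressed as a polynomial in the classical co-events; concretely, there exists a set 𝒮 of nonempty subsets of Ω such that φ(A) = ∑_{B ∈ 𝒮} B*(A) for all A ⊆ Ω, where the sum is taken in ZMod 2. -/
open scoped Classical in
/-- For a nonempty `B ⊆ Ω`, the dual co-event `B*`: it maps `A` to `1` iff `B ⊆ A`.
(`B*` is the product of the classical co-events `γ*` over `γ ∈ B`.) -/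
noncomputable def dualCoevent {Ω : Type*} (B : Set Ω) : Set Ω → ZMod 2 :=
  fun A => if B ⊆ A then 1 else 0

open scoped Classical in
/-- On a finite partial order every function is a sum of another one over lower intervals. -/
lemma exists_eq_sum_filter_le {α G : Type*} [PartialOrder α] [Fintype α] [AddCommGroup G]
    (f : α → G) : ∃ c : α → G, ∀ a, f a = ∑ b with b ≤ a, c b := by
  let step : (a : α) → ((b : α) → b < a → G) → G :=
    fun a c => f a - ∑ b : {b // b < a}, c b.1 b.2
  refine ⟨IsWellFounded.fix (· < ·) step, fun a => ?_⟩
  have hle : Finset.univ.filter (· ≤ a) = insert a (Finset.univ.filter (· < a)) := by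
    ext b
    simp [le_iff_eq_or_lt]
  rw [hle, Finset.sum_insert (by simp), IsWellFounded.fix_eq,
    Finset.sum_subtype (p := (· < a)) _ (by simp)]
  exact (sub_add_cancel _ _).symm

/-- Every co-event on a finite sample space can be expressed as a polynomial in the
classical co-events: it is a sum (in `ZMod 2`) of dual co-events `B*` over a set `𝒮`
of nonempty subsets of `Ω`. -/
theorem coevent_is_polynomial_in_classical_coevents {Ω : Type*} [Fintype Ω]
    (φ : Set Ω → ZMod 2) (h0 : φ ∅ = 0) :
    ∃ 𝒮 : Finset (Set Ω), (∀ B ∈ 𝒮, B.Nonempty) ∧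
      ∀ A : Set Ω, φ A = ∑ B ∈ 𝒮, dualCoevent B A := by
  classical
  obtain ⟨c, hc⟩ := exists_eq_sum_filter_le φ
  have hc_empty : c ∅ = 0 := by
    have hbot : Finset.univ.filter (fun B : Set Ω => B ≤ ∅) = {∅} := by
      ext B
      simp [Set.subset_empty_iff]
    have h := hc ∅
    rw [hbot, Finset.sum_singleton, h0] at h
    exact h.symm
  refine ⟨Finset.univ.filter (c · ≠ 0), fun B hB => ?_, fun A => ?_⟩
  · rw [Set.nonempty_iff_ne_empty]
    rintro rfl
    simp [hc_empty] at hB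
  · rw [hc, Finset.sum_filter, Finset.sum_filter]
    refine Finset.sum_congr rfl fun B _ => ?_
    have h_two : ∀ x : ZMod 2, x ≠ 0 → x = 1 := by decide
    by_cases hB : c B = 0
    · simp [hB]
    · simp [dualCoevent, h_two _ hB]
end

section
/- Let Ω be a finite type and μ : Set Ω → ℝ a map such that every subset of a null set is null (for all A ⊆ B ⊆ Ω, μ(B) = 0 implies μ(A) = 0). Then every primitive preclusive linear co-event φ on Ω is a homomorphism: there exists γ ∈ Ω with φ(A) = 1 exactly when γ ∈ A. In particular, if μ is a classical (finitely additive, nonnegative) measure, the primitive preclusive linear co-events coincide with the classical co-events γ* for γ lying in no null set. -/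
/-- A co-event is linear if it is additive with respect to symmetric difference. -/
def IsLinearCoevent {Ω : Type*} (φ : Set Ω → ZMod 2) : Prop :=
  ∀ A B : Set Ω, φ (symmDiff A B) = φ A + φ B

/-- A co-event is preclusive (w.r.t. `μ`) if it vanishes on all null sets. -/
def Preclusive {Ω : Type*} (μ : Set Ω → ℝ) (φ : Set Ω → ZMod 2) : Prop :=
  ∀ A : Set Ω, μ A = 0 → φ A = 0

/-- A primitive preclusive linear co-event: a nonzero preclusive linear co-event that is
not dominated by any other nonzero preclusive linear co-event (domination of `φ` by `ψ`
meaning `ψ {γ} = 1 → φ {γ} = 1` for all `γ`). -/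
def PrimitiveLinear {Ω : Type*} (μ : Set Ω → ℝ) (φ : Set Ω → ZMod 2) : Prop :=
  φ ∅ = 0 ∧ (∃ A : Set Ω, φ A = 1) ∧ IsLinearCoevent φ ∧ Preclusive μ φ ∧
    ∀ ψ : Set Ω → ZMod 2, ψ ∅ = 0 → (∃ A : Set Ω, ψ A = 1) → IsLinearCoevent ψ →
      Preclusive μ ψ → (∀ γ : Ω, ψ {γ} = 1 → φ {γ} = 1) → ψ = φ

theorem zmod_two_eq_one_iff {a : ZMod 2} : a = 1 ↔ a ≠ 0 := by
  revert a; decide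

theorem zmod_two_ext {a b : ZMod 2} (h : a = 1 ↔ b = 1) : a = b := by
  revert a b; decide

namespace IsLinearCoevent

variable {Ω : Type*} {φ ψ : Set Ω → ZMod 2}

theorem map_empty (hφ : IsLinearCoevent φ) : φ ∅ = 0 := by
  simpa using hφ ∅ ∅

theorem ext_singleton [Finite Ω] (hφ : IsLinearCoevent φ) (hψ : IsLinearCoevent ψ)
    (h : ∀ γ, φ {γ} = ψ {γ}) : φ = ψ := by
  funext A
  induction A, A.toFinite using Set.Finite.induction_on with
  | empty => rw [hφ.map_empty, hψ.map_empty]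
  | @insert a s ha _ ih =>
    have hs : insert a s = symmDiff {a} s := by
      rw [(Set.disjoint_singleton_left.2 ha).symmDiff_eq_sup]
      rfl
    rw [hs, hφ, hψ, h, ih]

theorem exists_singleton_eq_one [Finite Ω] (hφ : IsLinearCoevent φ) (hne : ∃ A, φ A = 1) :
    ∃ γ, φ {γ} = 1 := by
  by_contra! h
  obtain ⟨A, hA⟩ := hne
  have hzero : φ = fun _ => 0 :=
    hφ.ext_singleton (fun _ _ => (add_zero 0).symm) fun γ =>
      not_not.1 fun hγ => h γ (zmod_two_eq_one_iff.2 hγ)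
  simp [hzero] at hA

end IsLinearCoevent

open Classical in
/-- The classical co-event `γ*`. -/
noncomputable def classicalCoevent {Ω : Type*} (γ : Ω) (A : Set Ω) : ZMod 2 :=
  if γ ∈ A then 1 else 0

section ClassicalCoevent

variable {Ω : Type*}

theorem classicalCoevent_eq_one_iff {γ : Ω} {A : Set Ω} :
    classicalCoevent γ A = 1 ↔ γ ∈ A := by
  simp [classicalCoevent]

theorem eq_classicalCoevent_iff {φ : Set Ω → ZMod 2} {γ : Ω} :
    φ = classicalCoevent γ ↔ ∀ A, φ A = 1 ↔ γ ∈ A := by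
  refine ⟨?_, fun h => funext fun A => zmod_two_ext ?_⟩
  · rintro rfl A
    exact classicalCoevent_eq_one_iff
  · rw [h, classicalCoevent_eq_one_iff]

theorem isLinearCoevent_classicalCoevent (γ : Ω) : IsLinearCoevent (classicalCoevent γ) := by
  intro A B
  by_cases hA : γ ∈ A <;> by_cases hB : γ ∈ B <;>
    simp [classicalCoevent, Set.mem_symmDiff, hA, hB, CharTwo.add_self_eq_zero]

theorem preclusive_classicalCoevent_iff {μ : Set Ω → ℝ} {γ : Ω} :
    Preclusive μ (classicalCoevent γ) ↔ ∀ Z, μ Z = 0 → γ ∉ Z := by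
  simp [Preclusive, classicalCoevent]

theorem primitiveLinear_classicalCoevent [Finite Ω] {μ : Set Ω → ℝ} {γ : Ω}
    (hγ : ∀ Z, μ Z = 0 → γ ∉ Z) : PrimitiveLinear μ (classicalCoevent γ) := by
  have hlin := isLinearCoevent_classicalCoevent γ
  refine ⟨hlin.map_empty, ⟨{γ}, classicalCoevent_eq_one_iff.2 rfl⟩, hlin,
    preclusive_classicalCoevent_iff.2 hγ, fun ψ _ hne hψ _ hdom => ?_⟩
  obtain ⟨x, hx⟩ := hψ.exists_singleton_eq_one hne
  obtain rfl : γ = x := classicalCoevent_eq_one_iff.1 (hdom x hx)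
  refine hψ.ext_singleton hlin fun y => zmod_two_ext ⟨hdom y, fun hy => ?_⟩
  obtain rfl : γ = y := classicalCoevent_eq_one_iff.1 hy
  exact hx

theorem PrimitiveLinear.exists_eq_classicalCoevent [Finite Ω] {μ : Set Ω → ℝ}
    (hdown : ∀ A B : Set Ω, A ⊆ B → μ B = 0 → μ A = 0) {φ : Set Ω → ZMod 2}
    (hφ : PrimitiveLinear μ φ) :
    ∃ γ, (∀ Z, μ Z = 0 → γ ∉ Z) ∧ φ = classicalCoevent γ := by
  obtain ⟨-, hne, hlin, hpre, hmin⟩ := hφ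
  obtain ⟨γ, hγ⟩ := hlin.exists_singleton_eq_one hne
  have hnull : ∀ Z, μ Z = 0 → γ ∉ Z := fun Z hZ hmem =>
    zmod_two_eq_one_iff.1 hγ (hpre _ (hdown _ Z (Set.singleton_subset_iff.2 hmem) hZ))
  have hγlin := isLinearCoevent_classicalCoevent γ
  refine ⟨γ, hnull, (hmin _ hγlin.map_empty ⟨{γ}, classicalCoevent_eq_one_iff.2 rfl⟩ hγlin
    (preclusive_classicalCoevent_iff.2 hnull) fun x hx => ?_).symm⟩
  obtain rfl : γ = x := classicalCoevent_eq_one_iff.1 hx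
  exact hγ

end ClassicalCoevent

/-- If every subset of a null set is null, then every primitive preclusive linear co-event
is a homomorphism (a classical co-event `γ*`); in particular, for a classical measure the
primitive preclusive linear co-events are exactly the `γ*` with `γ` lying in no null set. -/
theorem linear_scheme_weak_emergent_classicality {Ω : Type*} [Fintype Ω] (μ : Set Ω → ℝ)
    (hdown : ∀ A B : Set Ω, A ⊆ B → μ B = 0 → μ A = 0) :
    (∀ φ : Set Ω → ZMod 2, PrimitiveLinear μ φ →
      ∃ γ : Ω, ∀ A : Set Ω, (φ A = 1 ↔ γ ∈ A)) ∧
    ((∀ A : Set Ω, 0 ≤ μ A) →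
     (∀ A B : Set Ω, Disjoint A B → μ (A ∪ B) = μ A + μ B) →
      ∀ φ : Set Ω → ZMod 2,
        (PrimitiveLinear μ φ ↔
          ∃ γ : Ω, (∀ Z : Set Ω, μ Z = 0 → γ ∉ Z) ∧
            ∀ A : Set Ω, (φ A = 1 ↔ γ ∈ A))) := by
  refine ⟨fun φ hφ => ?_, fun _ _ φ => ⟨fun hφ => ?_, ?_⟩⟩
  · obtain ⟨γ, -, h⟩ := hφ.exists_eq_classicalCoevent hdown
    exact ⟨γ, eq_classicalCoevent_iff.1 h⟩
  · obtain ⟨γ, hγ, h⟩ := hφ.exists_eq_classicalCoevent hdown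
    exact ⟨γ, hγ, eq_classicalCoevent_iff.1 h⟩
  · rintro ⟨γ, hγ, h⟩
    rw [eq_classicalCoevent_iff.2 h]
    exact primitiveLinear_classicalCoevent hγ
end

section
/- Let D be the 4×4 real matrix with rows (1,−1,−1,2), (−1,1,1,−2), (−1,1,1,−2), (2,−2,−2,4), and define μ : Set (Fin 4) → ℝ by μ(A) = ∑_{i∈A} ∑_{j∈A} D i j. Then: (i) D is positive semidefinite (the measure is strongly positive); (ii) μ({3}) ≠ 0; and yet (iii) every preclusive linear co-event φ on Fin 4 satisfies φ({3}) = 0. Hence the linear co-event scheme can preclude an event that is not dynamically precluded. -/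
open scoped Classical

/-- The decoherence functional matrix of the toy model. -/
noncomputable def D6 : Matrix (Fin 4) (Fin 4) ℝ :=
  !![1, -1, -1, 2;
     -1, 1, 1, -2;
     -1, 1, 1, -2;
     2, -2, -2, 4]

/-- The associated quantum measure `μ(A) = ∑_{i∈A} ∑_{j∈A} D i j`. -/
noncomputable def mu6 (A : Set (Fin 4)) : ℝ :=
  ∑ i : Fin 4, ∑ j : Fin 4, if i ∈ A ∧ j ∈ A then D6 i j else 0

theorem D6_eq_vecMulVec_star :
    D6 = Matrix.vecMulVec (![1, -1, -1, 2] : Fin 4 → ℝ) (star ![1, -1, -1, 2]) := by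
  ext i j
  fin_cases i <;> fin_cases j <;> norm_num [D6, Matrix.vecMulVec_apply]

/-- The measure is strongly positive, `μ {3} ≠ 0`, and yet every preclusive linear
co-event maps `{3}` to `0`: the linear scheme precludes an event that is not
dynamically precluded. -/
theorem linear_scheme_precludes_nonnull_event :
    D6.PosSemidef ∧
    mu6 {3} ≠ 0 ∧
    (∀ φ : Set (Fin 4) → ZMod 2, φ ∅ = 0 → IsLinearCoevent φ → Preclusive mu6 φ →
      φ {3} = 0) := by
  refine ⟨?_, ?_, fun φ _ hlin hprec => ?_⟩
  · rw [D6_eq_vecMulVec_star]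
    exact Matrix.posSemidef_vecMulVec_self_star _
  · simp [mu6, D6, Fin.sum_univ_four]
  · have h01 : φ {0, 1} = 0 := hprec _ (by simp [mu6, D6, Fin.sum_univ_four])
    have h02 : φ {0, 2} = 0 := hprec _ (by simp [mu6, D6, Fin.sum_univ_four])
    have h123 : φ {1, 2, 3} = 0 :=
      hprec _ (by simp [mu6, D6, Fin.sum_univ_four]; norm_num)
    have h3 : ({3} : Set (Fin 4)) =
        symmDiff (symmDiff {0, 1} {0, 2}) {1, 2, 3} := by
      ext x
      fin_cases x <;> simp [Set.mem_symmDiff]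
    rw [h3, hlin, hlin, h01, h02, h123]
    simp
end

section
/- Let Ω be the set of all colourings γ : PS → Bool of the Peres set, and for S ⊆ PS let G_S = {γ ∈ Ω | γ(u) = true for all u ∈ S} and R_S = {γ ∈ Ω | γ(u) = false for all u ∈ S}. Call a map φ : Set Ω → ZMod 2 PKS-preclusive if φ(R_B) = 0 for every set B of three pairwise orthogonal vectors in PS and φ(G_P) = 0 for every pair P of two distinct orthogonal vectors in PS. Then: (1) there exists a linear PKS-preclusive co-event φ with φ(Ω) = 1; (2) for every three pairwise orthogonal vectors u, v, w ∈ PS there exists a linear PKS-preclusive co-event φ with φ(Ω) = 1, φ(G_{{u}}) = 1, φ(R_{{v}}) = 1 and φ(R_{{w}}) = 1. -/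
/-- The Peres set of 33 rays (directions) in ℝ³. -/
def peresSet : Set (ℝ × ℝ × ℝ) :=
  {(0,0,1), (0,1,0), (1,0,0),
   (0,1,1), (0,1,-1), (1,0,1), (1,0,-1), (1,1,0), (1,-1,0),
   (0,1,2), (0,-1,2), (0,2,1), (0,2,-1), (1,0,2), (-1,0,2), (2,0,1), (2,0,-1),
   (1,2,0), (-1,2,0), (2,1,0), (2,-1,0),
   (1,1,2), (-1,1,2), (1,-1,2), (-1,-1,2), (1,2,1), (1,2,-1), (-1,2,1), (-1,2,-1),
   (2,1,1), (2,1,-1), (2,-1,1), (2,-1,-1)}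

/-- Euclidean dot product on ℝ³ (as ℝ × ℝ × ℝ). -/
def dot3 (u v : ℝ × ℝ × ℝ) : ℝ := u.1 * v.1 + u.2.1 * v.2.1 + u.2.2 * v.2.2

/-- The sample space Ω of all colourings of the Peres set (`true` = green, `false` = red). -/
abbrev PeresColouring : Type := {v : ℝ × ℝ × ℝ // v ∈ peresSet} → Bool

/-- `G_S`: the event that all rays in `S` are coloured green. -/
def greenOn (S : Set (ℝ × ℝ × ℝ)) : Set PeresColouring :=
  {γ | ∀ u : {v : ℝ × ℝ × ℝ // v ∈ peresSet}, (u : ℝ × ℝ × ℝ) ∈ S → γ u = true}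

/-- `R_S`: the event that all rays in `S` are coloured red. -/
def redOn (S : Set (ℝ × ℝ × ℝ)) : Set PeresColouring :=
  {γ | ∀ u : {v : ℝ × ℝ × ℝ // v ∈ peresSet}, (u : ℝ × ℝ × ℝ) ∈ S → γ u = false}

/-- A co-event is PKS-preclusive if it vanishes on `R_B` for each orthogonal basis `B`
in the Peres set and on `G_P` for each orthogonal pair `P` in the Peres set. -/
def PKSPreclusive (φ : Set PeresColouring → ZMod 2) : Prop :=
  (∀ u v w : ℝ × ℝ × ℝ, u ∈ peresSet → v ∈ peresSet → w ∈ peresSet →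
    u ≠ v → u ≠ w → v ≠ w → dot3 u v = 0 → dot3 u w = 0 → dot3 v w = 0 →
    φ (redOn {u, v, w}) = 0) ∧
  (∀ u v : ℝ × ℝ × ℝ, u ∈ peresSet → v ∈ peresSet → u ≠ v → dot3 u v = 0 →
    φ (greenOn {u, v}) = 0)

open Finset in
/-- Every function on the finite subsets of a finite type is the restriction to the events
`G_T` of a linear co-event, whose value on `R_T` is then given by inclusion-exclusion. -/
theorem exists_isLinearCoevent_of_finset {ι : Type*} [Fintype ι] [DecidableEq ι]
    (f : Finset ι → ZMod 2) :
    ∃ φ : Set (ι → Bool) → ZMod 2, IsLinearCoevent φ ∧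
      (∀ T : Finset ι, φ {γ | ∀ i ∈ T, γ i = true} = f T) ∧
      (∀ T : Finset ι, φ {γ | ∀ i ∈ T, γ i = false} = ∑ S ∈ T.powerset, f S) := by
  classical
  refine ⟨fun A => ∑ S, f S * ∑ T ∈ S.powerset, A.indicator 1 (fun i => decide (i ∈ T)),
    ?_, ?_, ?_⟩
  · intro A B
    simp only [← sum_add_distrib, ← mul_add]
    refine sum_congr rfl fun S _ => congrArg _ (sum_congr rfl fun T _ => ?_)
    by_cases hA : (fun i => decide (i ∈ T)) ∈ A <;>
      by_cases hB : (fun i => decide (i ∈ T)) ∈ B <;>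
      simp [Set.mem_symmDiff, hA, hB, CharTwo.add_self_eq_zero]
  · intro B
    have key (S : Finset ι) : ∑ T ∈ S.powerset,
        {γ : ι → Bool | ∀ i ∈ B, γ i = true}.indicator 1 (fun i => decide (i ∈ T))
        = if S = B then (1 : ZMod 2) else 0 := by
      have hcard : ∑ T ∈ S.powerset,
          {γ : ι → Bool | ∀ i ∈ B, γ i = true}.indicator 1 (fun i => decide (i ∈ T))
          = (#(Icc B S) : ZMod 2) := by
        simp only [Set.indicator_apply, Pi.one_apply, sum_boole]
        congr 2
        ext T
        simp [subset_iff, and_comm]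
      rw [hcard]
      by_cases hBS : B ⊆ S
      · rw [card_Icc_finset hBS]
        by_cases hSB : S = B
        · simp [hSB]
        · have hlt : #B < #S := card_lt_card (hBS.ssubset_of_ne (Ne.symm hSB))
          have h2 : (2 : ZMod 2) = 0 := rfl
          simp [hSB, h2, (Nat.sub_pos_of_lt hlt).ne']
      · have hSB : S ≠ B := fun h => hBS h.ge
        rw [Icc_eq_empty hBS, card_empty, Nat.cast_zero, if_neg hSB]
    simp [key]
  · intro B
    have key (S : Finset ι) : ∑ T ∈ S.powerset,
        {γ : ι → Bool | ∀ i ∈ B, γ i = false}.indicator 1 (fun i => decide (i ∈ T))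
        = if S ∈ B.powerset then (1 : ZMod 2) else 0 := by
      have hcard : ∑ T ∈ S.powerset,
          {γ : ι → Bool | ∀ i ∈ B, γ i = false}.indicator 1 (fun i => decide (i ∈ T))
          = (#(S \ B).powerset : ZMod 2) := by
        simp only [Set.indicator_apply, Pi.one_apply, sum_boole]
        congr 2
        ext T
        simp [subset_sdiff, disjoint_right]
      rw [hcard, card_powerset]
      by_cases hSB : S ⊆ B
      · simp [hSB, sdiff_eq_empty_iff_subset.2 hSB]
      · have h2 : (2 : ZMod 2) = 0 := rfl
        simp [hSB, h2]
    simp only [key, mul_ite, mul_one, mul_zero]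
    rw [← sum_filter, filter_univ_mem]

theorem sum_powerset_singleton {ι M : Type*} [DecidableEq ι] [AddCommMonoid M]
    (g : Finset ι → M) (a : ι) : ∑ S ∈ ({a} : Finset ι).powerset, g S = g ∅ + g {a} := by
  simpa using Finset.sum_powerset_insert (Finset.notMem_empty a) g

theorem finite_peresSet : peresSet.Finite := by
  unfold peresSet
  exact Set.toFinite _

/-- The weights `1` on `∅` and `{u}`, and `1` on the triples avoiding `u`, extend to a
PKS-preclusive linear co-event. -/
theorem exists_linear_pksPreclusive_green {u : ℝ × ℝ × ℝ} (hu : u ∈ peresSet) :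
    ∃ φ : Set PeresColouring → ZMod 2,
      φ ∅ = 0 ∧ IsLinearCoevent φ ∧ PKSPreclusive φ ∧ φ Set.univ = 1 ∧
      φ (greenOn {u}) = 1 ∧ ∀ v ∈ peresSet, u ≠ v → φ (redOn {v}) = 1 := by
  classical
  have : Fintype {v : ℝ × ℝ × ℝ // v ∈ peresSet} := finite_peresSet.fintype
  obtain ⟨φ, hlin, hgreen, hred⟩ := exists_isLinearCoevent_of_finset
    (fun S : Finset {v : ℝ × ℝ × ℝ // v ∈ peresSet} =>
      if S.card = 0 then (1 : ZMod 2) else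
      if S.card = 1 then (if ⟨u, hu⟩ ∈ S then 1 else 0) else
      if S.card = 3 then (if ⟨u, hu⟩ ∈ S then 0 else 1) else 0)
  refine ⟨φ, ?_, hlin, ⟨?_, ?_⟩, ?_, ?_, ?_⟩
  · simpa using hlin ∅ ∅
  · intro a b c ha hb hc hab hac hbc _ _ _
    have hset : redOn {a, b, c} = {γ : PeresColouring | ∀ i ∈
        ({⟨a, ha⟩, ⟨b, hb⟩, ⟨c, hc⟩} : Finset {v : ℝ × ℝ × ℝ // v ∈ peresSet}),
        γ i = false} := by
      ext γ
      simp only [redOn, Set.mem_ofPred_eq, Set.mem_insert_iff, Set.mem_singleton_iff,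
        Finset.mem_insert, Finset.mem_singleton, Subtype.ext_iff]
    rw [hset, hred, Finset.sum_powerset_insert (by simp [hab, hac]),
      Finset.sum_powerset_insert (by simp [hbc]), Finset.sum_powerset_insert (by simp [hbc])]
    simp only [sum_powerset_singleton]
    have h2 : (1 + 1 : ZMod 2) = 0 := rfl
    by_cases hua : u = a
    · subst hua
      simp [Finset.card_insert_of_notMem, hab, hac, hbc, h2]
    by_cases hub : u = b
    · subst hub
      simp [Finset.card_insert_of_notMem, hab, hac, hbc, hua, h2]
    by_cases huc : u = c
    · subst huc
      simp [Finset.card_insert_of_notMem, hab, hac, hbc, hua, hub, h2]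
    simp [Finset.card_insert_of_notMem, hab, hac, hbc, hua, hub, huc, h2]
  · intro a b ha hb hab _
    have hset : greenOn {a, b} = {γ : PeresColouring | ∀ i ∈
        ({⟨a, ha⟩, ⟨b, hb⟩} : Finset {v : ℝ × ℝ × ℝ // v ∈ peresSet}), γ i = true} := by
      ext γ
      simp only [greenOn, Set.mem_ofPred_eq, Set.mem_insert_iff, Set.mem_singleton_iff,
        Finset.mem_insert, Finset.mem_singleton, Subtype.ext_iff]
    rw [hset, hgreen, Finset.card_pair (by simpa using hab)]
    simp
  · simpa using hgreen ∅
  · have hset : greenOn {u} = {γ : PeresColouring | ∀ i ∈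
        ({⟨u, hu⟩} : Finset {v : ℝ × ℝ × ℝ // v ∈ peresSet}), γ i = true} := by
      ext γ
      simp only [greenOn, Set.mem_ofPred_eq, Set.mem_singleton_iff, Finset.mem_singleton,
        Subtype.ext_iff]
    rw [hset, hgreen]
    simp
  · intro v hv huv
    have hset : redOn {v} = {γ : PeresColouring | ∀ i ∈
        ({⟨v, hv⟩} : Finset {v : ℝ × ℝ × ℝ // v ∈ peresSet}), γ i = false} := by
      ext γ
      simp only [redOn, Set.mem_ofPred_eq, Set.mem_singleton_iff, Finset.mem_singleton,
        Subtype.ext_iff]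
    rw [hset, hred, sum_powerset_singleton]
    simp [huv]

/-- The linear co-event scheme can describe the Peres–Kochen–Specker system:
(1) there is a unital linear PKS-preclusive co-event; (2) for each basis of three
pairwise orthogonal Peres rays `u, v, w` there is a unital linear PKS-preclusive
co-event affirming `u` green and `v`, `w` red. -/
theorem linear_coevents_for_PKS :
    (∃ φ : Set PeresColouring → ZMod 2,
      φ ∅ = 0 ∧ IsLinearCoevent φ ∧ PKSPreclusive φ ∧ φ Set.univ = 1) ∧
    (∀ u v w : ℝ × ℝ × ℝ, u ∈ peresSet → v ∈ peresSet → w ∈ peresSet →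
      u ≠ v → u ≠ w → v ≠ w → dot3 u v = 0 → dot3 u w = 0 → dot3 v w = 0 →
      ∃ φ : Set PeresColouring → ZMod 2,
        φ ∅ = 0 ∧ IsLinearCoevent φ ∧ PKSPreclusive φ ∧ φ Set.univ = 1 ∧
        φ (greenOn {u}) = 1 ∧ φ (redOn {v}) = 1 ∧ φ (redOn {w}) = 1) := by
  constructor
  · have h0 : ((0, 0, 1) : ℝ × ℝ × ℝ) ∈ peresSet := by simp [peresSet]
    obtain ⟨φ, hempty, hlin, hpks, huniv, -⟩ := exists_linear_pksPreclusive_green h0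
    exact ⟨φ, hempty, hlin, hpks, huniv⟩
  · intro u v w hu hv hw huv huw _ _ _ _
    obtain ⟨φ, hempty, hlin, hpks, huniv, hgreen, hred⟩ := exists_linear_pksPreclusive_green hu
    exact ⟨φ, hempty, hlin, hpks, huniv, hgreen, hred v hv huv, hred w hw huw⟩
end

section
/- Let Ω be a finite type, and let n be an integer with 1 ≤ n < |Ω|. For every A ⊆ Ω there exist finitely many subsets A₁, …, A_k of Ω, each of cardinality at most n, such that φ(A) = φ(A₁) + ⋯ + φ(A_k) (in ZMod 2) for every map φ : Set Ω → ZMod 2 satisfying the order-n sum rule. -/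
instance {Ω : Type*} : Std.Commutative (α := Set Ω) symmDiff := ⟨symmDiff_comm⟩
instance {Ω : Type*} : Std.Associative (α := Set Ω) symmDiff := ⟨symmDiff_assoc⟩

/-- The symmetric difference `∆_{i ∈ s} A i` of a finite family of sets. -/
def finSymmDiff {ι Ω : Type*} (s : Finset ι) (A : ι → Set Ω) : Set Ω :=
  s.fold symmDiff ∅ A

/-- The order-`n` sum rule for a co-event `φ`: for all `A₁, …, A_{n+1}`,
`φ(A₁ ∆ ⋯ ∆ A_{n+1})` equals the sum (in `ZMod 2`) of `φ(∆_{i∈S} A_i)` over all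
nonempty `S ⊆ {1, …, n+1}` with `|S| ≤ n`. -/
def OrderSumRule {Ω : Type*} (n : ℕ) (φ : Set Ω → ZMod 2) : Prop :=
  ∀ A : Fin (n + 1) → Set Ω,
    φ (finSymmDiff Finset.univ A) =
      ∑ S ∈ Finset.univ.powerset.filter
          (fun S : Finset (Fin (n + 1)) => S.Nonempty ∧ S.card ≤ n),
        φ (finSymmDiff S A)

/-- The symmetric difference of color classes of a set is the part of the set whose colors
are selected. -/
theorem finSymmDiff_colorClasses {ι Ω : Type*} (s : Finset ι) (A : Set Ω) (c : Ω → ι) :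
    finSymmDiff s (fun i => {x ∈ A | c x = i}) = {x ∈ A | c x ∈ s} := by
  classical
  induction s using Finset.induction_on with
  | empty => simp [finSymmDiff]
  | insert i s hi ih =>
    unfold finSymmDiff at ih ⊢
    rw [Finset.fold_insert hi, ih]
    ext x
    simp only [Set.mem_symmDiff, Set.mem_ofPred_eq, Finset.mem_insert]
    grind

/-- A set with more than `n` elements has a coloring by `n + 1` colors using all colors. -/
theorem exists_coloring_surjOn {Ω : Type*} [Finite Ω] {n : ℕ} {A : Set Ω} (hA : n < A.ncard) :
    ∃ c : Ω → Fin (n + 1), ∀ i, ∃ x ∈ A, c x = i := by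
  have := Fintype.ofFinite A
  have hle : Fintype.card (Fin (n + 1)) ≤ Fintype.card A := by
    rw [Fintype.card_fin, ← Nat.card_eq_fintype_card, Nat.card_coe_set_eq]
    exact hA
  obtain ⟨f⟩ := Function.Embedding.nonempty_of_card_le hle
  have hf : Function.Injective fun i => (f i : Ω) := Subtype.val_injective.comp f.injective
  exact ⟨Function.invFun fun i => (f i : Ω),
    fun i => ⟨f i, (f i).2, Function.leftInverse_invFun hf i⟩⟩

theorem exists_multiset_decomposition {Ω : Type*} [Finite Ω] (n : ℕ) (A : Set Ω) :
    ∃ M : Multiset (Set Ω), (∀ B ∈ M, B.ncard ≤ n) ∧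
      ∀ φ : Set Ω → ZMod 2, OrderSumRule n φ → φ A = (M.map φ).sum := by
  induction hm : A.ncard using Nat.strong_induction_on generalizing A with
  | _ m ih =>
    subst hm
    rcases le_or_gt A.ncard n with hA | hA
    · exact ⟨{A}, by simpa using hA, by simp⟩
    obtain ⟨c, hc⟩ := exists_coloring_surjOn hA
    have hlt (S : Finset (Fin (n + 1))) (hS : S.card ≤ n) :
        {x ∈ A | c x ∈ S}.ncard < A.ncard := by
      obtain ⟨i, hi⟩ : ∃ i, i ∉ S := by
        by_contra! h
        rw [Finset.eq_univ_iff_forall.mpr h, Finset.card_fin] at hS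
        omega
      obtain ⟨x, hxA, rfl⟩ := hc i
      exact Set.ncard_lt_ncard
        ((Set.ssubset_iff_of_subset (Set.sep_subset _ _)).mpr ⟨x, hxA, fun h => hi h.2⟩)
    choose! M hMcard hMsum using fun S (hS : S.card ≤ n) => ih _ (hlt S hS) _ rfl
    refine ⟨∑ S ∈ Finset.univ.powerset.filter
      (fun S : Finset (Fin (n + 1)) => S.Nonempty ∧ S.card ≤ n), M S, ?_, ?_⟩
    · intro B hB
      obtain ⟨S, hS, hBS⟩ := Multiset.mem_sum.mp hB
      exact hMcard S (Finset.mem_filter.mp hS).2.2 B hBS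
    · intro φ hφ
      have h := hφ fun i => {x ∈ A | c x = i}
      simp only [finSymmDiff_colorClasses, Finset.mem_univ, and_true, Set.ofPred_mem_eq] at h
      rw [h, ← Multiset.coe_mapAddMonoidHom, map_sum, ← Multiset.coe_sumAddMonoidHom, map_sum]
      exact Finset.sum_congr rfl fun S hS => hMsum S (Finset.mem_filter.mp hS).2.2 φ hφ

/-- Every event can be decomposed, for all order-`n` co-events simultaneously, into
a sum of events of cardinality at most `n`. -/
theorem orderN_coevent_action_decomposition {Ω : Type*} [Fintype Ω] (n : ℕ)
    (hn : 1 ≤ n) (hcard : n < Fintype.card Ω) (A : Set Ω) :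
    ∃ (k : ℕ) (B : Fin k → Set Ω),
      (∀ i, (B i).ncard ≤ n) ∧
      ∀ φ : Set Ω → ZMod 2, OrderSumRule n φ → φ A = ∑ i, φ (B i) := by
  obtain ⟨M, hM, hsum⟩ := exists_multiset_decomposition n A
  induction M using Quotient.inductionOn with
  | _ l =>
    refine ⟨l.length, l.get, fun i => hM _ (l.get_mem i), fun φ hφ => ?_⟩
    rw [hsum φ hφ]
    simp [Fin.sum_univ_fun_getElem]
end

section
/- Let Ω be a finite type and n ≥ 1. A map φ : Set Ω → ZMod 2 satisfies the order-n sum rule if and only if φ is a polynomial of degree at most n in the classical co-events; concretely, if and only if there exists a set 𝒮 of nonempty subsets of Ω, each of cardinality at most n, such that φ(A) = ∑_{B ∈ 𝒮} B*(A) for all A ⊆ Ω (sum in ZMod 2). -/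
theorem finSymmDiff_insert {ι Ω : Type*} [DecidableEq ι] {s : Finset ι} {i : ι} (hi : i ∉ s)
    (A : ι → Set Ω) : finSymmDiff (insert i s) A = symmDiff (A i) (finSymmDiff s A) :=
  Finset.fold_insert hi

open scoped Classical in
theorem indicator_finSymmDiff {ι Ω : Type*} (s : Finset ι) (A : ι → Set Ω) (x : Ω) :
    (if x ∈ finSymmDiff s A then 1 else 0 : ZMod 2) = ∑ i ∈ s, if x ∈ A i then 1 else 0 := by
  induction s using Finset.induction_on with
  | empty => simp [finSymmDiff]
  | insert i s hi ih =>
    rw [finSymmDiff_insert hi, Finset.sum_insert hi, ← ih]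
    have h2 : (1 + 1 : ZMod 2) = 0 := by decide
    by_cases h : x ∈ A i <;> by_cases h' : x ∈ finSymmDiff s A <;>
      simp [Set.mem_symmDiff, h, h', h2]

theorem finSymmDiff_inter_fiber {ι Ω : Type*} (s : Finset ι) (A : Set Ω) (f : Ω → ι) :
    finSymmDiff s (fun i => A ∩ f ⁻¹' {i}) = A ∩ f ⁻¹' s := by
  classical
  induction s using Finset.induction_on with
  | empty => simp [finSymmDiff]
  | insert i s hi ih =>
    rw [finSymmDiff_insert hi, ih]
    ext x
    by_cases h : f x = i
    · simp [Set.mem_symmDiff, h, hi]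
    · simp [Set.mem_symmDiff, h]

theorem dualCoevent_eq_prod {Ω : Type*} (B : Set Ω) [Fintype B] (A : Set Ω)
    [∀ x, Decidable (x ∈ A)] :
    dualCoevent B A = ∏ b : B, if (b : Ω) ∈ A then 1 else 0 := by
  rw [Fintype.prod_boole, dualCoevent]
  classical exact if_congr (by simp [Set.subset_def]) rfl rfl

/-- A product of fewer than `|ι|` functions that are additive in `S ⊆ ι` sums to zero
over all `S`, in characteristic two. -/
theorem sum_prod_sum_eq_zero {ι β R : Type*} [Fintype ι] [Fintype β] [CommRing R] [CharP R 2]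
    (h : Fintype.card β < Fintype.card ι) (a : β → ι → R) :
    ∑ S : Finset ι, ∏ b, ∑ i ∈ S, a b i = 0 := by
  classical
  have expand (S : Finset ι) : ∏ b, ∑ i ∈ S, a b i =
      ∑ f : β → ι, ∏ b, if f b ∈ S then a b (f b) else 0 := by
    have := Finset.prod_univ_sum (fun _ : β => (Finset.univ : Finset ι))
      (fun b i => if i ∈ S then a b i else 0)
    simpa using this
  simp_rw [expand]
  rw [Finset.sum_comm]
  refine Finset.sum_eq_zero fun f _ => ?_
  obtain ⟨j, hj⟩ : ∃ j, ∀ b, f b ≠ j := by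
    by_contra! hf
    exact h.not_ge (Fintype.card_le_of_surjective f hf)
  refine Finset.sum_involution (fun S _ => symmDiff S {j}) (fun S _ => ?_) (fun S _ _ hS => ?_)
    (fun S _ => Finset.mem_univ _) (fun S _ => symmDiff_symmDiff_cancel_right _ _)
  · have hmem (b : β) : f b ∈ symmDiff S {j} ↔ f b ∈ S := by
      simp [Finset.mem_symmDiff, hj b]
    simp_rw [hmem]
    exact CharTwo.add_self_eq_zero _
  · simp at hS

theorem orderSumRule_of_sum_eq_zero {Ω : Type*} {n : ℕ} {φ : Set Ω → ZMod 2} (h0 : φ ∅ = 0)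
    (h : ∀ A : Fin (n + 1) → Set Ω, ∑ S, φ (finSymmDiff S A) = 0) : OrderSumRule n φ := by
  intro A
  have hA := h A
  have hfilter : Finset.univ.powerset.filter
      (fun S : Finset (Fin (n + 1)) => S.Nonempty ∧ S.card ≤ n) =
      (Finset.univ.erase Finset.univ).erase ∅ := by
    ext S
    have hS : S.card ≤ n ↔ S ≠ Finset.univ := by
      rw [← Finset.card_lt_iff_ne_univ, Fintype.card_fin, Nat.lt_succ_iff]
    simp [Finset.nonempty_iff_ne_empty, hS]
  rw [hfilter, Finset.sum_erase _ (by simpa [finSymmDiff] using h0)]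
  rw [← Finset.add_sum_erase _ _ (Finset.mem_univ Finset.univ)] at hA
  exact CharTwo.add_eq_zero.mp hA

theorem orderSumRule_dualCoevent {Ω : Type*} [Finite Ω] {n : ℕ} {B : Set Ω} (hB : B.Nonempty)
    (hn : B.ncard ≤ n) : OrderSumRule n (dualCoevent B) := by
  classical
  have := Fintype.ofFinite B
  refine orderSumRule_of_sum_eq_zero ?_ fun A => ?_
  · simp [dualCoevent, hB.ne_empty]
  · simp_rw [dualCoevent_eq_prod, indicator_finSymmDiff]
    refine sum_prod_sum_eq_zero ?_ _
    rw [← Nat.card_eq_fintype_card, Nat.card_coe_set_eq, Fintype.card_fin]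
    exact Nat.lt_succ_of_le hn

theorem OrderSumRule.sum {Ω κ : Type*} {n : ℕ} {s : Finset κ} {φ : κ → Set Ω → ZMod 2}
    (h : ∀ k ∈ s, OrderSumRule n (φ k)) : OrderSumRule n (fun A => ∑ k ∈ s, φ k A) := by
  intro A
  rw [Finset.sum_comm]
  exact Finset.sum_congr rfl fun k hk => h k hk A

theorem OrderSumRule.map_empty {Ω : Type*} {n : ℕ} {φ : Set Ω → ZMod 2}
    (h : OrderSumRule n φ) : φ ∅ = 0 := by
  have hempty (S : Finset (Fin (n + 1))) : finSymmDiff S (fun _ => (∅ : Set Ω)) = ∅ := by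
    simpa using finSymmDiff_inter_fiber S (∅ : Set Ω) (fun _ => 0)
  have := h fun _ => ∅
  simp_rw [hempty] at this
  rw [this]
  refine Finset.sum_involution (fun S _ => Sᶜ) (fun S _ => CharTwo.add_self_eq_zero _)
    (fun S _ _ hS => ?_) (fun S hS => ?_) (fun S _ => compl_compl S)
  · exact (compl_ne_self (a := S)) hS
  · simp only [Finset.powerset_univ, Finset.mem_filter, Finset.mem_univ, true_and] at hS ⊢
    have := hS.1.card_pos
    rw [← Finset.card_pos, Finset.card_compl, Fintype.card_fin]
    omega

/-- A co-event obeying the order-`n` sum rule is determined by its values on sets of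
cardinality at most `n`. -/
theorem OrderSumRule.ext_of_ncard_le {Ω : Type*} [Finite Ω] {n : ℕ} {φ ψ : Set Ω → ZMod 2}
    (hφ : OrderSumRule n φ) (hψ : OrderSumRule n ψ) (h : ∀ A : Set Ω, A.ncard ≤ n → φ A = ψ A)
    (A : Set Ω) : φ A = ψ A := by
  induction hm : A.ncard using Nat.strong_induction_on generalizing A with
  | _ m ih =>
  by_cases hA : A.ncard ≤ n
  · exact h A hA
  have := Fintype.ofFinite A
  obtain ⟨g⟩ : Nonempty (Fin (n + 1) ↪ A) := by
    rw [Function.Embedding.nonempty_iff_card_le, Fintype.card_fin, ← Nat.card_eq_fintype_card,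
      Nat.card_coe_set_eq]
    omega
  have hg : Function.Injective fun i => (g i : Ω) := Subtype.val_injective.comp g.injective
  set f := Function.invFun fun i => (g i : Ω)
  have hf (i : Fin (n + 1)) : f (g i) = i := Function.leftInverse_invFun hg i
  have hφA := hφ fun i => A ∩ f ⁻¹' {i}
  have hψA := hψ fun i => A ∩ f ⁻¹' {i}
  simp only [finSymmDiff_inter_fiber, Finset.coe_univ, Set.preimage_univ, Set.inter_univ]
    at hφA hψA
  rw [hφA, hψA]
  refine Finset.sum_congr rfl fun S hS => ih _ ?_ _ rfl
  rw [← hm]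
  refine Set.ncard_lt_ncard (Set.inter_subset_left.ssubset_of_ne fun heq => ?_)
  have huniv : S = Finset.univ := Finset.eq_univ_of_forall fun i => by
    have : (g i : Ω) ∈ A ∩ f ⁻¹' S := heq.symm.subset (g i).2
    simpa [hf] using this.2
  simp [huniv] at hS

theorem exists_sum_dualCoevent_eq_of_ncard_le {Ω : Type*} [Finite Ω] {φ : Set Ω → ZMod 2}
    (h0 : φ ∅ = 0) (n : ℕ) :
    ∃ 𝒮 : Finset (Set Ω), (∀ B ∈ 𝒮, B.Nonempty ∧ B.ncard ≤ n) ∧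
      ∀ A : Set Ω, A.ncard ≤ n → φ A = ∑ B ∈ 𝒮, dualCoevent B A := by
  classical
  have := Fintype.ofFinite (Set Ω)
  induction n with
  | zero =>
    refine ⟨∅, by simp, fun A hA => ?_⟩
    rw [Nat.le_zero, Set.ncard_eq_zero] at hA
    simp [hA, h0]
  | succ k ih =>
    obtain ⟨𝒮, h𝒮, hφ⟩ := ih
    set p : Set Ω → ZMod 2 := fun A => ∑ B ∈ 𝒮, dualCoevent B A
    set 𝒯 : Finset (Set Ω) := Finset.univ.filter fun B => B.ncard = k + 1 ∧ φ B ≠ p B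
    have hdisj : Disjoint 𝒮 𝒯 := by
      refine Finset.disjoint_left.mpr fun B hB hB' => ?_
      have h1 := (h𝒮 B hB).2
      have h2 := (Finset.mem_filter.mp hB').2.1
      omega
    refine ⟨𝒮 ∪ 𝒯, fun B hB => ?_, fun A hA => ?_⟩
    · rcases Finset.mem_union.mp hB with hB | hB
      · exact ⟨(h𝒮 B hB).1, (h𝒮 B hB).2.trans k.le_succ⟩
      · have h2 := (Finset.mem_filter.mp hB).2.1
        exact ⟨Set.nonempty_of_ncard_ne_zero (by omega), h2.le⟩
    · have hne : ∀ B ∈ 𝒯, B ≠ A → dualCoevent B A = 0 := fun B hB hBA => by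
        have h2 := (Finset.mem_filter.mp hB).2.1
        exact if_neg fun hsub => hBA (Set.eq_of_subset_of_ncard_le hsub (by omega))
      rw [Finset.sum_union hdisj]
      change φ A = p A + _
      by_cases hA𝒯 : A ∈ 𝒯
      · rw [Finset.sum_eq_single_of_mem A hA𝒯 hne]
        have h2 := (Finset.mem_filter.mp hA𝒯).2.2
        simp only [dualCoevent, subset_rfl, if_true]
        generalize φ A = x at h2 ⊢
        generalize p A = y at h2 ⊢
        revert x y
        decide
      · rw [Finset.sum_eq_zero fun B hB => hne B hB fun h => hA𝒯 (h ▸ hB), add_zero]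
        by_cases hk : A.ncard ≤ k
        · exact hφ A hk
        · by_contra hneq
          exact hA𝒯 (Finset.mem_filter.mpr ⟨Finset.mem_univ _, by omega, hneq⟩)

/-- A co-event satisfies the order-`n` sum rule iff it is a polynomial of degree at
most `n` in the classical co-events, i.e. a sum of dual co-events `B*` over a set of
nonempty subsets `B` of cardinality at most `n`. -/
theorem orderN_coevents_are_degreeN_polynomials {Ω : Type*} [Fintype Ω] (n : ℕ)
    (hn : 1 ≤ n) (φ : Set Ω → ZMod 2) :
    OrderSumRule n φ ↔
      ∃ 𝒮 : Finset (Set Ω), (∀ B ∈ 𝒮, B.Nonempty ∧ B.ncard ≤ n) ∧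
        ∀ A : Set Ω, φ A = ∑ B ∈ 𝒮, dualCoevent B A := by
  have hsum {𝒮 : Finset (Set Ω)} (h𝒮 : ∀ B ∈ 𝒮, B.Nonempty ∧ B.ncard ≤ n) :
      OrderSumRule n fun A => ∑ B ∈ 𝒮, dualCoevent B A :=
    OrderSumRule.sum fun B hB => orderSumRule_dualCoevent (h𝒮 B hB).1 (h𝒮 B hB).2
  constructor
  · intro h
    obtain ⟨𝒮, h𝒮, hφ⟩ := exists_sum_dualCoevent_eq_of_ncard_le h.map_empty n
    exact ⟨𝒮, h𝒮, h.ext_of_ncard_le (hsum h𝒮) hφ⟩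
  · rintro ⟨𝒮, h𝒮, hφ⟩
    rw [funext hφ]
    exact hsum h𝒮
end

section
/- For every integer n ≥ 1 there exist a nonempty finite type Ω, a function c : Ω → ℝ, an integer m ≥ 1, and subsets Z₁, …, Z_m of Ω such that: (i) the symmetric difference Z₁ ∆ ⋯ ∆ Z_m equals Ω; (ii) ∑_{γ ∈ Ω} c(γ) = 1; and (iii) for every nonempty index set T ⊆ {1, …, m} with |T| ≤ n, ∑_{γ ∈ ∆_{i∈T} Z_i} c(γ) = 0. (Consequently the quantum measure μ(A) = (∑_{γ∈A} c(γ))², which is strongly positive and has μ(Ω) = 1, makes every at-most-n-fold symmetric difference of the Z_i a null set while the Z_i sum to Ω, so this histories theory admits no unital preclusive n-polynomial co-event.) -/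
open scoped Classical

open Finset in
/-- A point lies in a finite symmetric difference iff it lies in an odd number of the sets. -/
theorem mem_finSymmDiff_iff {ι Ω : Type*} (s : Finset ι) (A : ι → Set Ω) (x : Ω)
    [DecidablePred (x ∈ A ·)] :
    x ∈ finSymmDiff s A ↔ Odd #{i ∈ s | x ∈ A i} := by
  classical
  induction s using Finset.induction_on with
  | empty => simp [finSymmDiff]
  | insert a s ha ih =>
    rw [finSymmDiff, Finset.fold_insert ha, ← finSymmDiff, Set.mem_symmDiff, ih,
      Finset.filter_insert]
    by_cases hx : x ∈ A a
    · rw [if_pos hx, Finset.card_insert_of_notMem (by simp [ha]), Nat.odd_add_one]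
      tauto
    · rw [if_neg hx]
      tauto

namespace BooleanFourier

open Finset

variable {ι : Type*} [DecidableEq ι]

/-- The Walsh character `S ↦ (-1) ^ |S ∩ T|`. -/
def walsh (T S : Finset ι) : ℝ := (-1) ^ #(S ∩ T)

theorem walsh_eq_prod (T S : Finset ι) : walsh T S = ∏ i ∈ S, if i ∈ T then -1 else 1 := by
  rw [walsh, Finset.prod_ite, Finset.prod_const, Finset.prod_const_one, mul_one,
    Finset.filter_mem_eq_inter]

theorem walsh_empty (S : Finset ι) : walsh ∅ S = 1 := by simp [walsh]

theorem ite_odd_card_inter (T S : Finset ι) (a : ℝ) :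
    (if Odd #(S ∩ T) then a else 0) = (a * walsh ∅ S - a * walsh T S) / 2 := by
  rw [walsh_empty, walsh]
  split_ifs with h
  · rw [h.neg_one_pow]; ring
  · rw [(Nat.not_odd_iff_even.mp h).neg_one_pow]; ring

variable [Fintype ι]

theorem walsh_compl (T S : Finset ι) : walsh Tᶜ S = (-1) ^ #S * walsh T S := by
  have h : #(S ∩ T) + #(S ∩ Tᶜ) = #S := by
    rw [← Finset.sdiff_eq_inter_compl, Finset.card_inter_add_card_sdiff]
  rw [walsh, walsh, ← h, pow_add, mul_right_comm, ← mul_pow]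
  norm_num

theorem sum_walsh_mul_walsh (T U : Finset ι) :
    ∑ S, walsh T S * walsh U S = if T = U then 2 ^ Fintype.card ι else 0 := by
  simp only [walsh_eq_prod, ← Finset.prod_mul_distrib]
  rw [← Finset.powerset_univ, ← Finset.prod_one_add]
  split_ifs with h
  · subst h
    rw [← Finset.card_univ, ← Finset.prod_const]
    refine Finset.prod_congr rfl fun i _ => ?_
    split_ifs <;> norm_num
  · obtain ⟨i, hi⟩ : ∃ i, ¬(i ∈ T ↔ i ∈ U) := by
      by_contra! hc
      exact h (Finset.ext hc)
    refine Finset.prod_eq_zero (Finset.mem_univ i) ?_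
    by_cases hT : i ∈ T <;> by_cases hU : i ∈ U <;> simp_all

/-- The function on subsets with prescribed Walsh coefficients `f`. -/
noncomputable def inverseWalsh (f : Finset ι → ℝ) (S : Finset ι) : ℝ :=
  (∑ T, f T * walsh T S) / 2 ^ Fintype.card ι

theorem sum_inverseWalsh_mul_walsh (f : Finset ι → ℝ) (U : Finset ι) :
    ∑ S, inverseWalsh f S * walsh U S = f U := by
  simp only [inverseWalsh, div_mul_eq_mul_div, ← Finset.sum_div, Finset.sum_mul, mul_assoc]
  rw [Finset.sum_comm]
  simp [← Finset.mul_sum, sum_walsh_mul_walsh]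

/-- Coefficients that are odd under complementation give a function supported on sets of odd
cardinality. -/
theorem inverseWalsh_eq_zero_of_even {f : Finset ι → ℝ} (hf : ∀ T, f Tᶜ = -f T)
    {S : Finset ι} (hS : Even #S) : inverseWalsh f S = 0 := by
  have h : ∑ T, f T * walsh T S = -∑ T, f T * walsh T S := by
    rw [← Finset.sum_neg_distrib]
    refine Fintype.sum_equiv (compl_involutive (α := Finset ι)).toPerm _ _ fun T => ?_
    simp [hf, walsh_compl, hS.neg_one_pow]
  rw [inverseWalsh, show ∑ T, f T * walsh T S = 0 by linarith, zero_div]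

theorem sum_odd_inverseWalsh_mul_walsh {f : Finset ι → ℝ} (hf : ∀ T, f Tᶜ = -f T)
    (U : Finset ι) :
    ∑ S : {S : Finset ι // Odd #S}, inverseWalsh f S * walsh U S = f U := by
  rw [← sum_inverseWalsh_mul_walsh f U,
    ← Finset.sum_subtype {S : Finset ι | Odd #S} (by simp) fun S => inverseWalsh f S * walsh U S]
  refine Finset.sum_subset (Finset.subset_univ _) fun S _ hS => ?_
  rw [inverseWalsh_eq_zero_of_even hf (by simpa using hS), zero_mul]

end BooleanFourier

/-- For every `n ≥ 1` there is a nonempty finite sample space (taken as `Fin N`),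
an amplitude function `c` with total amplitude `1` (so the quantum measure
`μ(A) = (∑_{γ∈A} c γ)²` is strongly positive and unital), and sets `Z₁, …, Z_m` whose
symmetric difference is the whole sample space while every at-most-`n`-fold symmetric
difference of the `Z_i` has total amplitude `0` (hence is null): so this histories
theory admits no unital preclusive `n`-polynomial co-event. -/
theorem orderN_problem_structure_exists (n : ℕ) (hn : 1 ≤ n) :
    ∃ (N : ℕ), 1 ≤ N ∧
      ∃ (c : Fin N → ℝ) (m : ℕ), 1 ≤ m ∧
        ∃ Z : Fin m → Set (Fin N),
          finSymmDiff Finset.univ Z = Set.univ ∧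
          (∑ γ : Fin N, c γ) = 1 ∧
          ∀ T : Finset (Fin m), T.Nonempty → T.card ≤ n →
            (∑ γ : Fin N, if γ ∈ finSymmDiff T Z then c γ else 0) = 0 := by
  let f : Finset (Fin (2 * n + 1)) → ℝ := fun T => if T.card ≤ n then 1 else -1
  have hf : ∀ T, f Tᶜ = -f T := fun T => by
    have hT : T.card + Tᶜ.card = 2 * n + 1 := by simp [T.card_add_card_compl]
    by_cases h : T.card ≤ n
    · simp only [f, if_pos h, if_neg (show ¬Tᶜ.card ≤ n by lia)]
    · simp only [f, if_neg h, if_pos (show Tᶜ.card ≤ n by lia), neg_neg]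
  let Ω := {S : Finset (Fin (2 * n + 1)) // Odd S.card}
  let e : Fin (Fintype.card Ω) ≃ Ω := (Fintype.equivFin Ω).symm
  have : Nonempty Ω := ⟨⟨{0}, by simp⟩⟩
  have hsum : ∀ U, ∑ γ, BooleanFourier.inverseWalsh f (e γ) * BooleanFourier.walsh U (e γ) = f U :=
    fun U => (e.sum_comp fun S : Ω =>
      BooleanFourier.inverseWalsh f S * BooleanFourier.walsh U S).trans
        (BooleanFourier.sum_odd_inverseWalsh_mul_walsh hf U)
  have hmem : ∀ (T : Finset (Fin (2 * n + 1))) γ,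
      γ ∈ finSymmDiff T (fun i => {γ | i ∈ (e γ).1}) ↔ Odd ((e γ).1 ∩ T).card := fun T γ => by
    rw [mem_finSymmDiff_iff, Finset.inter_comm, ← Finset.filter_mem_eq_inter]
    simp only [Set.mem_ofPred_eq]
  refine ⟨Fintype.card Ω, Fintype.card_pos, fun γ => BooleanFourier.inverseWalsh f (e γ),
    2 * n + 1, by lia, fun i => {γ | i ∈ (e γ).1}, ?_, ?_, fun T _ hT => ?_⟩
  · ext γ
    simpa [hmem] using (e γ).2
  · simpa [BooleanFourier.walsh_empty, f] using hsum ∅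
  · simp only [hmem, BooleanFourier.ite_odd_card_inter]
    rw [← Finset.sum_div, Finset.sum_sub_distrib, hsum, hsum]
    simp [f, hT]
end

section
/- Let Ω be a finite type and μ : Set Ω → ℝ a classical measure, i.e., μ(A) ≥ 0 for all A and μ(A ∪ B) = μ(A) + μ(B) whenever A and B are disjoint. Then a map φ : Set Ω → ZMod 2 is a primitive preclusive multiplicative co-event if and only if there exists γ ∈ Ω lying in no null set such that φ(A) = 1 exactly when γ ∈ A. That is, for a classical measure the multiplicative scheme reduces to the classical co-events. -/
/-- A co-event is multiplicative if `φ(A ∩ B) = φ(A)·φ(B)`. -/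
def IsMultiplicative {Ω : Type*} (φ : Set Ω → ZMod 2) : Prop :=
  ∀ A B : Set Ω, φ (A ∩ B) = φ A * φ B

/-- A primitive preclusive multiplicative co-event: a nonzero preclusive multiplicative
co-event not dominated by any other (domination of `φ` by `ψ` meaning
`φ A = 1 → ψ A = 1` for all `A`). -/
def PrimitiveMult {Ω : Type*} (μ : Set Ω → ℝ) (φ : Set Ω → ZMod 2) : Prop :=
  φ ∅ = 0 ∧ (∃ A : Set Ω, φ A = 1) ∧ IsMultiplicative φ ∧ Preclusive μ φ ∧
    ∀ ψ : Set Ω → ZMod 2, ψ ∅ = 0 → (∃ A : Set Ω, ψ A = 1) → IsMultiplicative ψ →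
      Preclusive μ ψ → (∀ A : Set Ω, φ A = 1 → ψ A = 1) → ψ = φ

theorem zmod_two_mul_eq_one_iff (a b : ZMod 2) : a * b = 1 ↔ a = 1 ∧ b = 1 := by
  revert a b
  decide

theorem zmod_two_eq_of_eq_one_iff (a b : ZMod 2) (h : a = 1 ↔ b = 1) : a = b := by
  revert a b
  decide

/-- A finitely additive set function on a finite type vanishes on every set all of whose
singletons are null. -/
theorem eq_zero_of_forall_singleton_eq_zero {Ω : Type*} [Finite Ω] {μ : Set Ω → ℝ}
    (hadd : ∀ A B : Set Ω, Disjoint A B → μ (A ∪ B) = μ A + μ B) (A : Set Ω)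
    (hA : ∀ γ ∈ A, μ {γ} = 0) : μ A = 0 := by
  induction A, A.toFinite using Set.Finite.induction_on with
  | empty => simpa using hadd ∅ ∅ (Set.disjoint_empty _)
  | @insert a s ha _ ih =>
    rw [Set.insert_eq, hadd _ _ (Set.disjoint_singleton_left.2 ha), hA a (Set.mem_insert _ _),
      ih fun γ hγ => hA γ (Set.mem_insert_of_mem _ hγ), add_zero]

theorem apply_mono_of_nonneg_of_additive {Ω : Type*} {μ : Set Ω → ℝ}
    (hpos : ∀ A : Set Ω, 0 ≤ μ A)
    (hadd : ∀ A B : Set Ω, Disjoint A B → μ (A ∪ B) = μ A + μ B) {A B : Set Ω}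
    (h : A ⊆ B) : μ A ≤ μ B := by
  have := hadd A (B \ A) Set.disjoint_sdiff_right
  rw [Set.union_sdiff_cancel h] at this
  linarith [hpos (B \ A)]

/-- A nonzero multiplicative co-event on a finite type takes the value `1` on a set contained
in every set on which it takes the value `1`. -/
theorem IsMultiplicative.exists_least {Ω : Type*} [Finite Ω] {φ : Set Ω → ZMod 2}
    (hmul : IsMultiplicative φ) (hne : ∃ A : Set Ω, φ A = 1) :
    ∃ S : Set Ω, φ S = 1 ∧ ∀ A : Set Ω, φ A = 1 → S ⊆ A := by
  obtain ⟨S, hS⟩ := (Set.toFinite {A : Set Ω | φ A = 1}).exists_minimal hne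
  refine ⟨S, hS.prop, fun A hA => ?_⟩
  have hSA : φ (S ∩ A) = 1 := by
    rw [hmul, zmod_two_mul_eq_one_iff]
    exact ⟨hS.prop, hA⟩
  exact (hS.le_of_le hSA Set.inter_subset_left).trans Set.inter_subset_right

/-- For a classical (nonnegative, finitely additive) measure, the primitive preclusive
multiplicative co-events are precisely the classical co-events `γ*` with `γ` lying in
no null set. -/
theorem multiplicative_scheme_classical_measure {Ω : Type*} [Fintype Ω]
    (μ : Set Ω → ℝ) (hpos : ∀ A : Set Ω, 0 ≤ μ A)
    (hadd : ∀ A B : Set Ω, Disjoint A B → μ (A ∪ B) = μ A + μ B)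
    (φ : Set Ω → ZMod 2) :
    PrimitiveMult μ φ ↔
      ∃ γ : Ω, (∀ Z : Set Ω, μ Z = 0 → γ ∉ Z) ∧
        ∀ A : Set Ω, (φ A = 1 ↔ γ ∈ A) := by
  classical
  constructor
  · rintro ⟨-, hne, hmul, hprec, hmax⟩
    obtain ⟨S, hS, hleast⟩ := hmul.exists_least hne
    have hμS : μ S ≠ 0 := fun h => by simp [hprec S h] at hS
    obtain ⟨γ, hγS, hγ⟩ : ∃ γ ∈ S, μ {γ} ≠ 0 := by
      by_contra! h
      exact hμS (eq_zero_of_forall_singleton_eq_zero hadd S h)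
    have hnull : ∀ Z : Set Ω, μ Z = 0 → γ ∉ Z := fun Z hZ hmem =>
      hγ <| le_antisymm
        (hZ ▸ apply_mono_of_nonneg_of_additive hpos hadd (Set.singleton_subset_iff.2 hmem))
        (hpos _)
    have hψ : (fun A : Set Ω => if γ ∈ A then (1 : ZMod 2) else 0) = φ := by
      refine hmax _ (by simp) ⟨{γ}, by simp⟩ (fun A B => ?_) (fun A hA => ?_) (fun A hA => ?_)
      · by_cases hA : γ ∈ A <;> by_cases hB : γ ∈ B <;> simp [hA, hB]
      · exact if_neg (hnull A hA)
      · exact if_pos (hleast A hA hγS)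
    exact ⟨γ, hnull, fun A => by simp [← hψ]⟩
  · rintro ⟨γ, hnull, hφ⟩
    have hzero : ∀ A : Set Ω, γ ∉ A → φ A = 0 := fun A hA =>
      zmod_two_eq_of_eq_one_iff _ _ (by simp [hφ, hA])
    refine ⟨hzero ∅ (Set.notMem_empty γ), ⟨{γ}, (hφ _).2 rfl⟩, fun A B => ?_,
      fun A hA => hzero A (hnull A hA), fun ψ hψ₀ _ hψmul _ hdom => ?_⟩
    · apply zmod_two_eq_of_eq_one_iff
      rw [zmod_two_mul_eq_one_iff, hφ, hφ, hφ, Set.mem_inter_iff]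
    · funext A
      refine zmod_two_eq_of_eq_one_iff _ _ ⟨fun hA => ?_, hdom A⟩
      rw [hφ]
      by_contra hγA
      have h : ψ (A ∩ {γ}) = 1 := by
        rw [hψmul, zmod_two_mul_eq_one_iff]
        exact ⟨hA, hdom _ ((hφ _).2 rfl)⟩
      rw [Set.inter_singleton_eq_empty.2 hγA, hψ₀] at h
      exact zero_ne_one h
end

section
/- Let Ω be a finite type and μ : Set Ω → ℝ a map satisfying the quantum (level-2) sum rule: μ(A ∪ B ∪ C) = μ(A ∪ B) + μ(B ∪ C) + μ(A ∪ C) − μ(A) − μ(B) − μ(C) for all pairwise disjoint A, B, C ⊆ Ω. Let S be a finite set of nonzero multiplicative co-events on Ω and p : S → ℝ with p(φ) ≥ 0 for all φ ∈ S, such that for every A ⊆ Ω, ∑_{φ ∈ S with φ(A) = 1} p(φ) = μ(A). Then every φ ∈ S with p(φ) ≠ 0 satisfies the quadratic sum rule. -/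
/-- The quadratic sum rule for a co-event. -/
def QuadraticSumRule {Ω : Type*} (φ : Set Ω → ZMod 2) : Prop :=
  ∀ A B C : Set Ω,
    φ (symmDiff (symmDiff A B) C) =
      φ (symmDiff A B) + φ (symmDiff B C) + φ (symmDiff A C) + φ A + φ B + φ C

/-- The third-order interference term of the event indicator of a co-event. -/
noncomputable def interference {Ω : Type*} (φ : Set Ω → ZMod 2) (A B C : Set Ω) : ℝ :=
  (if φ (A ∪ B ∪ C) = 1 then 1 else 0) - (if φ (A ∪ B) = 1 then 1 else 0)
    - (if φ (B ∪ C) = 1 then 1 else 0) - (if φ (A ∪ C) = 1 then 1 else 0)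
    + (if φ A = 1 then 1 else 0) + (if φ B = 1 then 1 else 0)
    + (if φ C = 1 then 1 else 0)

namespace IsMultiplicative

variable {Ω : Type*} {φ : Set Ω → ZMod 2}

/-- On a finite type, a nonzero multiplicative co-event is the indicator of the supersets of
a single set. -/
theorem exists_forall_eq_one_iff_subset [Finite Ω] (hφ : IsMultiplicative φ)
    (hne : ∃ A, φ A = 1) : ∃ F : Set Ω, ∀ A, φ A = 1 ↔ F ⊆ A := by
  obtain ⟨F, hF, hmin⟩ := wellFounded_lt.has_min {A : Set Ω | φ A = 1} hne
  have hF : φ F = 1 := hF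
  refine ⟨F, fun A => ⟨fun hA => ?_, fun h => ?_⟩⟩
  · have hAF : φ (A ∩ F) = 1 := by rw [hφ, hA, hF, one_mul]
    by_contra hsub
    exact hmin _ hAF ⟨Set.inter_subset_right, fun h => hsub (h.trans Set.inter_subset_left)⟩
  · have hAF := hφ A F
    rwa [Set.inter_eq_right.mpr h, hF, mul_one, eq_comm] at hAF

/-- The third-order interference of a multiplicative co-event is nonnegative. -/
theorem interference_nonneg (hφ : IsMultiplicative φ) (h0 : φ ∅ = 0) {A B C : Set Ω}
    (hAB : Disjoint A B) (hBC : Disjoint B C) (hAC : Disjoint A C) :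
    0 ≤ interference φ A B C := by
  unfold interference
  have eA : φ A = φ (A ∪ B) * φ (A ∪ C) := by
    rw [← hφ, ← Set.union_inter_distrib_left, hBC.inter_eq, Set.union_empty]
  have eB : φ B = φ (A ∪ B) * φ (B ∪ C) := by
    rw [← hφ, Set.union_comm A B, ← Set.union_inter_distrib_left, hAC.inter_eq, Set.union_empty]
  have eC : φ C = φ (A ∪ C) * φ (B ∪ C) := by
    rw [← hφ, ← Set.inter_union_distrib_right, hAB.inter_eq, Set.empty_union]
  have eAB : φ A * φ B = 0 := by rw [← hφ, hAB.inter_eq, h0]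
  have e1 : φ (A ∪ B) = φ (A ∪ B) * φ (A ∪ B ∪ C) := by
    rw [← hφ, Set.inter_eq_left.mpr Set.subset_union_left]
  have e2 : φ (B ∪ C) = φ (B ∪ C) * φ (A ∪ B ∪ C) := by
    rw [← hφ, Set.inter_eq_left.mpr (by rw [Set.union_assoc]; exact Set.subset_union_right)]
  have e3 : φ (A ∪ C) = φ (A ∪ C) * φ (A ∪ B ∪ C) := by
    rw [← hφ, Set.inter_eq_left.mpr (Set.union_subset_union_left C Set.subset_union_left)]
  rw [eA, eB] at eAB
  rw [eA, eB, eC]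
  generalize φ (A ∪ B ∪ C) = w at *
  generalize φ (A ∪ B) = x at *
  generalize φ (B ∪ C) = y at *
  generalize φ (A ∪ C) = z at *
  clear eA eB eC hφ h0 hAB hBC hAC
  have key : ∀ v : ZMod 2, v = 0 ∨ v = 1 := by decide
  rcases key w with rfl | rfl <;> rcases key x with rfl | rfl <;>
    rcases key y with rfl | rfl <;> rcases key z with rfl | rfl <;>
    first
    | exact absurd eAB (by decide)
    | exact absurd e1 (by decide)
    | exact absurd e2 (by decide)
    | exact absurd e3 (by decide)
    | norm_num

end IsMultiplicative

/-- The indicator of the supersets of a pair satisfies the quadratic sum rule. -/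
theorem quadraticSumRule_of_forall_eq_one_iff {Ω : Type*} {φ : Set Ω → ZMod 2} {x y : Ω}
    (h : ∀ A, φ A = 1 ↔ x ∈ A ∧ y ∈ A) : QuadraticSumRule φ := by
  classical
  have hφ : ∀ A, φ A = if x ∈ A ∧ y ∈ A then 1 else 0 := by
    intro A
    split_ifs with hA
    · exact (h A).mpr hA
    · exact by_contra fun h0 => hA ((h A).mp (Fin.eq_one_of_ne_zero _ h0))
  intro A B C
  simp only [hφ, Set.mem_symmDiff]
  by_cases x ∈ A <;> by_cases x ∈ B <;> by_cases x ∈ C <;>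
  by_cases y ∈ A <;> by_cases y ∈ B <;> by_cases y ∈ C <;> simp [*] <;> decide

/-- If a probability distribution `p` on a finite set `S` of nonzero multiplicative
co-events reproduces a quantum (level-2) measure `μ` via
`μ(A) = ∑_{φ ∈ S, φ(A) = 1} p(φ)`, then every co-event of nonzero probability satisfies
the quadratic sum rule. -/
theorem dynamical_multiplicative_coevents_are_quadratic {Ω : Type*} [Fintype Ω]
    (μ : Set Ω → ℝ)
    (hsum : ∀ A B C : Set Ω, Disjoint A B → Disjoint B C → Disjoint A C →
      μ (A ∪ B ∪ C) = μ (A ∪ B) + μ (B ∪ C) + μ (A ∪ C) - μ A - μ B - μ C)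
    (S : Finset (Set Ω → ZMod 2))
    (hS : ∀ φ ∈ S, φ ∅ = 0 ∧ (∃ A : Set Ω, φ A = 1) ∧ IsMultiplicative φ)
    (p : (Set Ω → ZMod 2) → ℝ) (hp : ∀ φ ∈ S, 0 ≤ p φ)
    (hmatch : ∀ A : Set Ω, ∑ φ ∈ S.filter (fun φ => φ A = 1), p φ = μ A) :
    ∀ φ ∈ S, p φ ≠ 0 → QuadraticSumRule φ := by
  intro φ hφS hpφ
  obtain ⟨h0, hne, hmul⟩ := hS φ hφS
  obtain ⟨F, hF⟩ := hmul.exists_forall_eq_one_iff_subset hne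
  have hFne : F.Nonempty := by
    rw [Set.nonempty_iff_ne_empty]
    rintro rfl
    simp [(hF ∅).mpr subset_rfl] at h0
  obtain ⟨x, hx⟩ := hFne
  have hpair : ∃ y ∈ F, F ⊆ {x, y} := by
    by_contra! hno
    obtain ⟨y, hy, hyx⟩ := Set.not_subset.mp (hno x hx)
    obtain ⟨z, hz, hzxy⟩ := Set.not_subset.mp (hno y hy)
    simp only [Set.mem_insert_iff, Set.mem_singleton_iff, or_self, not_or] at hyx hzxy
    have hAB : Disjoint ({x} : Set Ω) {y} := by simpa using Ne.symm hyx
    have hBC : Disjoint ({y} : Set Ω) (F \ {x, y}) := by simp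
    have hAC : Disjoint ({x} : Set Ω) (F \ {x, y}) := by simp
    have hzero := hsum _ _ _ hAB hBC hAC
    simp only [← hmatch, Finset.sum_filter] at hzero
    have hnonneg := fun ψ (hψ : ψ ∈ S) => mul_nonneg (hp ψ hψ)
      ((hS ψ hψ).2.2.interference_nonneg (hS ψ hψ).1 hAB hBC hAC)
    have htotal : ∑ ψ ∈ S, p ψ * interference ψ {x} {y} (F \ {x, y}) = 0 := by
      simp only [interference, mul_add, mul_sub, mul_ite, mul_one, mul_zero,
        Finset.sum_add_distrib, Finset.sum_sub_distrib]
      linarith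
    have hterm := (Finset.sum_eq_zero_iff_of_nonneg hnonneg).mp htotal φ hφS
    have hABC : F ⊆ {x} ∪ {y} ∪ F \ {x, y} := by
      intro w hw
      by_cases w = x <;> by_cases w = y <;> simp_all
    have nAB : ¬ F ⊆ {x} ∪ {y} := fun h => by simpa [hzxy] using h hz
    have nBC : ¬ F ⊆ {y} ∪ F \ {x, y} := fun h => by simpa [Ne.symm hyx] using h hx
    have nAC : ¬ F ⊆ {x} ∪ F \ {x, y} := fun h => by simpa [hyx] using h hy
    have nA : ¬ F ⊆ {x} := fun h => nAB (h.trans Set.subset_union_left)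
    have nB : ¬ F ⊆ {y} := fun h => nAB (h.trans Set.subset_union_right)
    have nC : ¬ F ⊆ F \ {x, y} := fun h => nAC (h.trans Set.subset_union_right)
    simp only [← hF] at hABC nAB nBC nAC nA nB nC
    simp only [interference, if_pos hABC, if_neg nAB, if_neg nBC, if_neg nAC, if_neg nA,
      if_neg nB, if_neg nC] at hterm
    exact hpφ (by linarith)
  obtain ⟨y, hy, hsub⟩ := hpair
  refine quadraticSumRule_of_forall_eq_one_iff (x := x) (y := y) fun A => ?_
  rw [hF]
  exact ⟨fun h => ⟨h hx, h hy⟩, fun h => hsub.trans (Set.pair_subset h.1 h.2)⟩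
end

section
/- Let Ω be a type and φ : Set Ω → ZMod 2 any map. Then φ satisfies φ(A ∪ B ∪ C) = φ(A ∪ B) + φ(B ∪ C) + φ(A ∪ C) + φ(A) + φ(B) + φ(C) for all pairwise disjoint A, B, C ⊆ Ω if and only if φ satisfies the quadratic sum rule φ(A ∆ B ∆ C) = φ(A ∆ B) + φ(B ∆ C) + φ(A ∆ C) + φ(A) + φ(B) + φ(C) for all (not necessarily disjoint) A, B, C ⊆ Ω. -/
/-- A map satisfying the disjoint sum rule is determined on a disjoint union of four sets by its
values on the six pairwise unions. -/
theorem disjoint_sum_rule_four {Ω : Type*} {φ : Set Ω → ZMod 2}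
    (h : ∀ A B C : Set Ω, Disjoint A B → Disjoint B C → Disjoint A C →
      φ (A ∪ B ∪ C) = φ (A ∪ B) + φ (B ∪ C) + φ (A ∪ C) + φ A + φ B + φ C)
    {W X Y Z S : Set Ω} (hWX : Disjoint W X) (hWY : Disjoint W Y) (hWZ : Disjoint W Z)
    (hXY : Disjoint X Y) (hXZ : Disjoint X Z) (hYZ : Disjoint Y Z)
    (hS : S = W ∪ X ∪ Y ∪ Z) :
    φ S = φ (W ∪ X) + φ (W ∪ Y) + φ (W ∪ Z) + φ (X ∪ Y) + φ (X ∪ Z) + φ (Y ∪ Z) := by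
  have h₁ := h (W ∪ X) Y Z (hWY.union_left hXY) hYZ (hWZ.union_left hXZ)
  have h₂ := h W X Y hWX hXY hWY
  have h₃ := h W X Z hWX hXZ hWZ
  have two : (2 : ZMod 2) = 0 := rfl
  rw [hS, h₁, h₂, h₃]
  linear_combination (φ (W ∪ X) + φ W + φ X + φ Y + φ Z) * two

/-- A co-event satisfies the quadratic sum rule on pairwise disjoint triples (with union
in place of symmetric difference) if and only if it satisfies the quadratic sum rule for
arbitrary triples of events. -/
theorem disjoint_sum_rule_iff_quadratic_sum_rule {Ω : Type*} (φ : Set Ω → ZMod 2) :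
    (∀ A B C : Set Ω, Disjoint A B → Disjoint B C → Disjoint A C →
      φ (A ∪ B ∪ C) = φ (A ∪ B) + φ (B ∪ C) + φ (A ∪ C) + φ A + φ B + φ C) ↔
    (∀ A B C : Set Ω,
      φ (symmDiff (symmDiff A B) C) =
        φ (symmDiff A B) + φ (symmDiff B C) + φ (symmDiff A C) + φ A + φ B + φ C) := by
  constructor
  · intro h A B C
    obtain ⟨a, ha⟩ : ∃ a, a = A ∩ Bᶜ ∩ Cᶜ := ⟨_, rfl⟩
    obtain ⟨b, hb⟩ : ∃ b, b = Aᶜ ∩ B ∩ Cᶜ := ⟨_, rfl⟩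
    obtain ⟨c, hc⟩ : ∃ c, c = Aᶜ ∩ Bᶜ ∩ C := ⟨_, rfl⟩
    obtain ⟨ab, hab⟩ : ∃ ab, ab = A ∩ B ∩ Cᶜ := ⟨_, rfl⟩
    obtain ⟨ac, hac⟩ : ∃ ac, ac = A ∩ Bᶜ ∩ C := ⟨_, rfl⟩
    obtain ⟨bc, hbc⟩ : ∃ bc, bc = Aᶜ ∩ B ∩ C := ⟨_, rfl⟩
    obtain ⟨abc, habc⟩ : ∃ abc, abc = A ∩ B ∩ C := ⟨_, rfl⟩
    have expand : ∀ {W X Y Z S : Set Ω}, Disjoint W X ∧ Disjoint W Y ∧ Disjoint W Z ∧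
        Disjoint X Y ∧ Disjoint X Z ∧ Disjoint Y Z ∧ S = W ∪ X ∪ Y ∪ Z →
        φ S = φ (W ∪ X) + φ (W ∪ Y) + φ (W ∪ Z) + φ (X ∪ Y) + φ (X ∪ Z) + φ (Y ∪ Z) :=
      fun ⟨h₁, h₂, h₃, h₄, h₅, h₆, h₇⟩ => disjoint_sum_rule_four h h₁ h₂ h₃ h₄ h₅ h₆ h₇
    have hA : φ A = _ :=
      expand (W := a) (X := ab) (Y := ac) (Z := abc) (by
        simp only [ha, hab, hac, habc, Set.disjoint_left, Set.ext_iff, Set.mem_union,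
          Set.mem_inter_iff, Set.mem_compl_iff]
        clear * -
        refine ⟨?_, ?_, ?_, ?_, ?_, ?_, ?_⟩ <;> intro x <;> tauto)
    have hB : φ B = _ :=
      expand (W := b) (X := ab) (Y := bc) (Z := abc) (by
        simp only [hb, hab, hbc, habc, Set.disjoint_left, Set.ext_iff, Set.mem_union,
          Set.mem_inter_iff, Set.mem_compl_iff]
        clear * -
        refine ⟨?_, ?_, ?_, ?_, ?_, ?_, ?_⟩ <;> intro x <;> tauto)
    have hC : φ C = _ :=
      expand (W := c) (X := ac) (Y := bc) (Z := abc) (by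
        simp only [hc, hac, hbc, habc, Set.disjoint_left, Set.ext_iff, Set.mem_union,
          Set.mem_inter_iff, Set.mem_compl_iff]
        clear * -
        refine ⟨?_, ?_, ?_, ?_, ?_, ?_, ?_⟩ <;> intro x <;> tauto)
    have hAB : φ (symmDiff A B) = _ :=
      expand (W := a) (X := b) (Y := ac) (Z := bc) (by
        simp only [ha, hb, hac, hbc, Set.disjoint_left, Set.ext_iff, Set.mem_union,
          Set.mem_inter_iff, Set.mem_compl_iff, Set.mem_symmDiff]
        clear * -
        refine ⟨?_, ?_, ?_, ?_, ?_, ?_, ?_⟩ <;> intro x <;> tauto)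
    have hBC : φ (symmDiff B C) = _ :=
      expand (W := b) (X := c) (Y := ab) (Z := ac) (by
        simp only [hb, hc, hab, hac, Set.disjoint_left, Set.ext_iff, Set.mem_union,
          Set.mem_inter_iff, Set.mem_compl_iff, Set.mem_symmDiff]
        clear * -
        refine ⟨?_, ?_, ?_, ?_, ?_, ?_, ?_⟩ <;> intro x <;> tauto)
    have hAC : φ (symmDiff A C) = _ :=
      expand (W := a) (X := c) (Y := ab) (Z := bc) (by
        simp only [ha, hc, hab, hbc, Set.disjoint_left, Set.ext_iff, Set.mem_union,
          Set.mem_inter_iff, Set.mem_compl_iff, Set.mem_symmDiff]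
        clear * -
        refine ⟨?_, ?_, ?_, ?_, ?_, ?_, ?_⟩ <;> intro x <;> tauto)
    have hABC : φ (symmDiff (symmDiff A B) C) = _ :=
      expand (W := a) (X := b) (Y := c) (Z := abc) (by
        simp only [ha, hb, hc, habc, Set.disjoint_left, Set.ext_iff, Set.mem_union,
          Set.mem_inter_iff, Set.mem_compl_iff, Set.mem_symmDiff]
        clear * -
        refine ⟨?_, ?_, ?_, ?_, ?_, ?_, ?_⟩ <;> intro x <;> tauto)
    rw [hA, hB, hC, hAB, hBC, hAC, hABC]
    ring_nf
    reduce_mod_char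
  · intro h A B C hAB hBC hAC
    have hS := h A B C
    have hABC : symmDiff (A ∪ B) C = A ∪ B ∪ C := (hAC.union_left hBC).symmDiff_eq_sup
    rwa [show symmDiff A B = A ∪ B from hAB.symmDiff_eq_sup,
      show symmDiff B C = B ∪ C from hBC.symmDiff_eq_sup,
      show symmDiff A C = A ∪ C from hAC.symmDiff_eq_sup, hABC] at hS
end

section
/- Let Ω be a finite type and φ : Set Ω → ZMod 2 a nonzero multiplicative co-event. Let ι : ZMod 2 → ℤ be the map with ι(0) = 0 and ι(1) = 1. Then for all pairwise disjoint A, B, C ⊆ Ω, the integer R = ι(φ(A ∪ B ∪ C)) − ι(φ(A ∪ B)) − ι(φ(B ∪ C)) − ι(φ(A ∪ C)) + ι(φ(A)) + ι(φ(B)) + ι(φ(C)) equals 0 or 1. -/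
/-- For a nonzero multiplicative co-event `φ` and pairwise disjoint events `A`, `B`, `C`,
the integer
`R = ι(φ(A∪B∪C)) − ι(φ(A∪B)) − ι(φ(B∪C)) − ι(φ(A∪C)) + ι(φ(A)) + ι(φ(B)) + ι(φ(C))`
(where `ι : ZMod 2 → ℤ` sends `0 ↦ 0`, `1 ↦ 1`) equals `0` or `1`. -/
theorem multiplicative_coevent_R_is_zero_or_one {Ω : Type*} [Fintype Ω]
    (φ : Set Ω → ZMod 2) (h0 : φ ∅ = 0) (hne : ∃ A : Set Ω, φ A = 1)
    (hmul : ∀ A B : Set Ω, φ (A ∩ B) = φ A * φ B)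
    (A B C : Set Ω) (hAB : Disjoint A B) (hBC : Disjoint B C) (hAC : Disjoint A C) :
    (((φ (A ∪ B ∪ C)).val : ℤ) - ((φ (A ∪ B)).val : ℤ) - ((φ (B ∪ C)).val : ℤ)
        - ((φ (A ∪ C)).val : ℤ) + ((φ A).val : ℤ) + ((φ B).val : ℤ) + ((φ C).val : ℤ)
      = 0) ∨
    (((φ (A ∪ B ∪ C)).val : ℤ) - ((φ (A ∪ B)).val : ℤ) - ((φ (B ∪ C)).val : ℤ)
        - ((φ (A ∪ C)).val : ℤ) + ((φ A).val : ℤ) + ((φ B).val : ℤ) + ((φ C).val : ℤ)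
      = 1) := by
  have hB : φ B = φ (A ∪ B) * φ (B ∪ C) := by
    rw [← hmul, Set.union_comm A B, ← Set.union_inter_distrib_left, hAC.inter_eq, Set.union_empty]
  have hA : φ A = φ (A ∪ B) * φ (A ∪ C) := by
    rw [← hmul, ← Set.union_inter_distrib_left, hBC.inter_eq, Set.union_empty]
  have hC : φ C = φ (B ∪ C) * φ (A ∪ C) := by
    rw [← hmul, ← Set.inter_union_distrib_right, hAB.symm.inter_eq, Set.empty_union]
  have hxyz : φ A * φ B = 0 := by rw [← hmul, hAB.inter_eq, h0]
  have mono : ∀ {S T : Set Ω}, S ⊆ T → φ S = φ S * φ T := fun h => by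
    rw [← hmul, Set.inter_eq_left.mpr h]
  have hx : φ (A ∪ B) = φ (A ∪ B) * φ (A ∪ B ∪ C) := mono (by grind)
  have hy : φ (B ∪ C) = φ (B ∪ C) * φ (A ∪ B ∪ C) := mono (by grind)
  have hz : φ (A ∪ C) = φ (A ∪ C) * φ (A ∪ B ∪ C) := mono (by grind)
  rw [hA, hB] at hxyz
  rw [hA, hB, hC]
  generalize φ (A ∪ B ∪ C) = u at *
  generalize φ (A ∪ B) = x at *
  generalize φ (B ∪ C) = y at *
  generalize φ (A ∪ C) = z at *
  clear hA hB hC mono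
  revert u x y z
  decide
end

section
/- Let N ≥ 1 and let D be an N×N complex matrix that is Hermitian (equal to its conjugate transpose) and satisfies ∑_{i,j} D i j = 1. Define μ : Set (Fin N) → ℂ by μ(A) = ∑_{i∈A} ∑_{j∈A} D i j. Then there exists a nonzero map φ : Set (Fin N) → ZMod 2 such that μ(A) = 0 implies φ(A) = 0 for all A ⊆ Fin N, and φ satisfies the quadratic sum rule. (Existence of a nonzero preclusive quadratic co-event for any decoherence functional.) -/
open scoped Classical

/-- The quantum measure `μ(A) = ∑_{i∈A} ∑_{j∈A} D i j` of a decoherence functional `D`. -/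
noncomputable def decMeasure {N : ℕ} (D : Matrix (Fin N) (Fin N) ℂ)
    (A : Set (Fin N)) : ℂ :=
  ∑ i : Fin N, ∑ j : Fin N, if i ∈ A ∧ j ∈ A then D i j else 0

/-- A quadratic form in indicator functions over `ZMod 2` satisfies the quadratic sum rule. -/
theorem quadraticSumRule_sum {ι : Type*} [Fintype ι] (c : ι → ι → ZMod 2) :
    QuadraticSumRule fun A : Set ι => ∑ i, ∑ j, if i ∈ A ∧ j ∈ A then c i j else 0 := by
  intro A B C
  simp only [← Finset.sum_add_distrib]
  refine Finset.sum_congr rfl fun i _ => Finset.sum_congr rfl fun j _ => ?_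
  simp only [Set.mem_symmDiff]
  by_cases hiA : i ∈ A <;> by_cases hiB : i ∈ B <;> by_cases hiC : i ∈ C <;>
    by_cases hjA : j ∈ A <;> by_cases hjB : j ∈ B <;> by_cases hjC : j ∈ C <;>
    simp [hiA, hiB, hiC, hjA, hjB, hjC, CharTwo.add_self_eq_zero]

/-- A nontrivial free abelian group admits a nonzero homomorphism to `ZMod 2`. -/
theorem exists_addMonoidHom_zmod_two_ne_zero (M : Type*) [AddCommGroup M] [Module.Free ℤ M]
    [Nontrivial M] : ∃ ψ : M →+ ZMod 2, ∃ m, ψ m ≠ 0 := by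
  let b := Module.Free.chooseBasis ℤ M
  obtain ⟨k⟩ := b.index_nonempty
  exact ⟨(Int.castAddHom (ZMod 2)).comp (b.coord k).toAddMonoidHom, b k, by simp⟩

/-- Folding a double sum onto the pairs `i ≤ j`. -/
theorem sum_sum_eq_sum_sum_fold {ι R : Type*} [Fintype ι] [LinearOrder ι] [AddCommMonoid R]
    (f : ι → ι → R) :
    ∑ i, ∑ j, f i j =
      ∑ i, ∑ j, if i < j then f i j + f j i else if i = j then f i i else 0 := by
  have hswap : ∑ i, ∑ j, (if i < j then f j i else 0) =
      ∑ i, ∑ j, (if j < i then f i j else 0) := Finset.sum_comm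
  have hsplit : ∀ i j, (if i < j then f i j + f j i else if i = j then f i i else 0) =
      (if i < j then f i j else 0) + (if i = j then f i i else 0) +
        (if i < j then f j i else 0) := by
    intro i j
    rcases lt_trichotomy i j with h | rfl | h
    · simp [h, h.ne]
    · simp
    · simp [h.not_gt, h.ne']
  simp only [hsplit, Finset.sum_add_distrib, hswap]
  simp only [← Finset.sum_add_distrib]
  refine Finset.sum_congr rfl fun i _ => Finset.sum_congr rfl fun j _ => ?_
  rcases lt_trichotomy i j with h | rfl | h
  · simp [h, h.ne, h.not_gt]
  · simp
  · simp [h, h.not_gt, h.ne']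

theorem decMeasure_singleton {N : ℕ} (D : Matrix (Fin N) (Fin N) ℂ) (i : Fin N) :
    decMeasure D {i} = D i i := by
  simp [decMeasure, ite_and]

theorem decMeasure_pair {N : ℕ} (D : Matrix (Fin N) (Fin N) ℂ) {i j : Fin N} (h : i ≠ j) :
    decMeasure D {i, j} = D i i + D j j + (D i j + D j i) := by
  have hsum : ∀ g : Fin N → ℂ, ∑ k, (if k = i ∨ k = j then g k else 0) = g i + g j := by
    intro g
    rw [← Finset.sum_filter, ← Finset.sum_pair h]
    congr 1
    ext k
    simp
  simp only [decMeasure, Set.mem_insert_iff, Set.mem_singleton_iff, ite_and,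
    Finset.sum_ite_irrel, Finset.sum_const_zero, hsum]
  ring

/-- The coefficient of the monomial `x i * x j`, `i ≤ j`, of the polynomial representing
`decMeasure D` on indicator functions. -/
noncomputable def decCoeff {N : ℕ} (D : Matrix (Fin N) (Fin N) ℂ) (i j : Fin N) : ℂ :=
  if i < j then D i j + D j i else if i = j then D i i else 0

theorem decMeasure_eq_sum_decCoeff {N : ℕ} (D : Matrix (Fin N) (Fin N) ℂ) (A : Set (Fin N)) :
    decMeasure D A = ∑ i, ∑ j, if i ∈ A ∧ j ∈ A then decCoeff D i j else 0 := by
  rw [decMeasure, sum_sum_eq_sum_sum_fold]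
  refine Finset.sum_congr rfl fun i _ => Finset.sum_congr rfl fun j _ => ?_
  unfold decCoeff
  by_cases hi : i ∈ A <;> by_cases hj : j ∈ A <;> simp [hi, hj]
  rintro - rfl
  exact absurd hi hj

theorem decCoeff_mem_span {N : ℕ} (D : Matrix (Fin N) (Fin N) ℂ) (i j : Fin N) :
    decCoeff D i j ∈ Submodule.span ℤ (Set.range (decMeasure D)) := by
  have hmem : ∀ A, decMeasure D A ∈ Submodule.span ℤ (Set.range (decMeasure D)) :=
    fun A => Submodule.subset_span ⟨A, rfl⟩
  unfold decCoeff
  split_ifs with hlt heq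
  · have h := sub_mem (sub_mem (hmem {i, j}) (hmem {i})) (hmem {j})
    rw [decMeasure_pair D hlt.ne, decMeasure_singleton, decMeasure_singleton] at h
    convert h using 1
    ring
  · rw [← decMeasure_singleton D i]
    exact hmem {i}
  · exact zero_mem _

/-- For every Hermitian decoherence functional `D` with `∑_{i,j} D i j = 1`, there is a
nonzero preclusive quadratic co-event: a nonzero map `φ : Set (Fin N) → ZMod 2` vanishing
on every set of measure zero and satisfying the quadratic sum rule. -/
theorem quadratic_coevent_existence (N : ℕ) (hN : 1 ≤ N)
    (D : Matrix (Fin N) (Fin N) ℂ) (hherm : D.IsHermitian)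
    (hunit : ∑ i : Fin N, ∑ j : Fin N, D i j = 1) :
    ∃ φ : Set (Fin N) → ZMod 2,
      (∃ A : Set (Fin N), φ A = 1) ∧
      (∀ A : Set (Fin N), decMeasure D A = 0 → φ A = 0) ∧
      QuadraticSumRule φ := by
  let G := Submodule.span ℤ (Set.range (decMeasure D))
  let m : Set (Fin N) → G := fun A => ⟨decMeasure D A, Submodule.subset_span ⟨A, rfl⟩⟩
  have hfin : Module.Finite ℤ G := Module.Finite.span_of_finite ℤ (Set.finite_range _)
  have hne : Nontrivial G := by
    refine ⟨m Set.univ, 0, fun h => ?_⟩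
    have h0 : decMeasure D Set.univ = 0 := congrArg Subtype.val h
    simp [decMeasure, hunit] at h0
  obtain ⟨ψ, g, hg⟩ := exists_addMonoidHom_zmod_two_ne_zero G
  refine ⟨fun A => ψ (m A), ?_, fun A hA => ?_, ?_⟩
  · by_contra! hall
    have hzero : ∀ A, ψ (m A) = 0 := fun A => by
      have htwo : ∀ t : ZMod 2, t ≠ 1 → t = 0 := by decide
      exact htwo _ (hall A)
    refine hg ?_
    obtain ⟨x, hx⟩ := g
    induction hx using Submodule.span_induction with
    | mem x h =>
      obtain ⟨A, rfl⟩ := h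
      exact hzero A
    | zero => exact map_zero ψ
    | add x y hx hy ihx ihy =>
      have h := map_add ψ (⟨x, hx⟩ : G) ⟨y, hy⟩
      simp_all
    | smul n x hx ih =>
      have h := map_zsmul ψ n (⟨x, hx⟩ : G)
      simp_all
  · have h0 : m A = 0 := Subtype.ext hA
    simp [h0]
  · have hm : ∀ A, m A = ∑ i, ∑ j,
        if i ∈ A ∧ j ∈ A then (⟨decCoeff D i j, decCoeff_mem_span D i j⟩ : G) else 0 := by
      intro A
      refine Subtype.ext ?_
      simp only [m, decMeasure_eq_sum_decCoeff, AddSubmonoidClass.coe_finsetSum]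
      refine Finset.sum_congr rfl fun i _ => Finset.sum_congr rfl fun j _ => ?_
      split_ifs <;> rfl
    simp only [hm, map_sum, apply_ite ψ, map_zero]
    exact quadraticSumRule_sum _
end
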